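/- Let M ≥ 1, let Λ ⊆ ℕ^M be a nonempty finite monotone set of multi-indices, and let S ⊆ R(Λ) be nonempty. Then the minimal norm of the reduced margin does not decrease under enrichment: min_{ν ∈ R(Λ ∪ S)} ‖ν − 1‖₁ ≥ min_{ν ∈ R(Λ)} ‖ν − 1‖₁. More precisely, every ν ∈ R(Λ ∪ S) either belongs to R(Λ), or satisfies ν = μ + e_m for some μ ∈ S and some m, in which case ‖ν − 1‖₁ ≥ 1 + min_{μ' ∈ R(Λ)} ‖μ' − 1‖₁. -/

import Mathlib

/-- The `m`-th unit multi-index `e_m`. -/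
def unitIdx (M : ℕ) (m : Fin M) : Fin M → ℕ := fun j => if j = m then 1 else 0

/-- A finite set `Λ ⊆ ℕ^M` of multi-indices (all entries `≥ 1`) is monotone
(downward closed) if `ν ∈ Λ` and `ν_m > 1` imply `ν − e_m ∈ Λ`. -/
def IsMonotoneIndexSet {M : ℕ} (Λ : Finset (Fin M → ℕ)) : Prop :=
  (∀ ν ∈ Λ, ∀ m, 1 ≤ ν m) ∧ ∀ ν ∈ Λ, ∀ m, 1 < ν m → ν - unitIdx M m ∈ Λ

/-- The reduced margin `R(Λ) = {ν ∈ ℕ^M \ Λ : ν − e_m ∈ Λ for all m with ν_m > 1}`. -/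
def redMargin {M : ℕ} (Λ : Finset (Fin M → ℕ)) : Set (Fin M → ℕ) :=
  {ν | (∀ m, 1 ≤ ν m) ∧ ν ∉ Λ ∧ ∀ m, 1 < ν m → ν - unitIdx M m ∈ Λ}

/-- `‖ν − 1‖₁ = Σ_m (ν_m − 1)` for a multi-index `ν`. -/
def nrmOne {M : ℕ} (ν : Fin M → ℕ) : ℕ := ∑ m, (ν m - 1)

lemma sub_unitIdx_add_unitIdx {M : ℕ} {ν : Fin M → ℕ} {m : Fin M} (h : 1 ≤ ν m) :
    ν - unitIdx M m + unitIdx M m = ν := by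
  funext j
  by_cases hj : j = m
  · subst hj
    simpa [unitIdx] using Nat.sub_add_cancel h
  · simp [unitIdx, hj]

lemma nrmOne_add_unitIdx {M : ℕ} {μ : Fin M → ℕ} (hμ : ∀ j, 1 ≤ μ j) (m : Fin M) :
    nrmOne (μ + unitIdx M m) = nrmOne μ + 1 := by
  have h : ∀ j, (μ + unitIdx M m) j - 1 = (μ j - 1) + if j = m then 1 else 0 := by
    intro j
    have := hμ j
    simp only [Pi.add_apply, unitIdx]
    omega
  simp only [nrmOne, h, Finset.sum_add_distrib]
  simp

lemma one_le_sub_unitIdx {M : ℕ} {ν : Fin M → ℕ} (hν : ∀ j, 1 ≤ ν j) {m : Fin M}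
    (hm : 1 < ν m) (j : Fin M) : 1 ≤ (ν - unitIdx M m) j := by
  have := hν j
  by_cases hj : j = m
  · subst hj
    simp only [Pi.sub_apply, unitIdx, if_true]
    omega
  · simpa [unitIdx, hj] using this

/-- A positive multi-index outside `Λ` of minimal norm lies in the reduced margin of `Λ`. -/
lemma redMargin_nonempty {M : ℕ} (hM : 1 ≤ M) (Λ : Finset (Fin M → ℕ)) :
    (redMargin Λ).Nonempty := by
  have hinj : Function.Injective (fun n : ℕ => (fun _ : Fin M => n + 1)) := by
    intro a b hab
    simpa using congrFun hab ⟨0, hM⟩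
  obtain ⟨_, ⟨n, rfl⟩, hn⟩ := (Set.infinite_range_of_injective hinj).exists_notMem_finset Λ
  obtain ⟨ν, ⟨hν, hνΛ⟩, hmin⟩ := exists_minimalFor_of_wellFoundedLT
    (fun ν : Fin M → ℕ => (∀ j, 1 ≤ ν j) ∧ ν ∉ Λ) nrmOne ⟨_, fun _ => Nat.le_add_left 1 n, hn⟩
  refine ⟨ν, hν, hνΛ, fun m hm => ?_⟩
  by_contra hout
  have hpos := one_le_sub_unitIdx hν hm
  have hnorm := nrmOne_add_unitIdx hpos m
  rw [sub_unitIdx_add_unitIdx hm.le] at hnorm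
  have := hmin ⟨hpos, hout⟩ (by omega)
  omega

/-- Enriching a monotone index set by a subset of its reduced margin does not
decrease the minimal norm of the reduced margin; more precisely, every element
of the new reduced margin either lies in the old one, or equals `μ + e_m` for
some marked `μ ∈ S` and then its norm is at least `1 +` the old minimum. -/
theorem reduced_margin_minimal_norm_monotone
    (M : ℕ) (hM : 1 ≤ M) (Λ : Finset (Fin M → ℕ))
    (hne : Λ.Nonempty) (hΛ : IsMonotoneIndexSet Λ)
    (S : Finset (Fin M → ℕ)) (hSne : S.Nonempty) (hS : ↑S ⊆ redMargin Λ) :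
    sInf (nrmOne '' redMargin Λ) ≤ sInf (nrmOne '' redMargin (Λ ∪ S)) ∧
    ∀ ν ∈ redMargin (Λ ∪ S),
      ν ∈ redMargin Λ ∨
      ∃ μ ∈ S, ∃ m : Fin M, ν = μ + unitIdx M m ∧
        1 + sInf (nrmOne '' redMargin Λ) ≤ nrmOne ν := by
  have hle : ∀ μ ∈ redMargin Λ, sInf (nrmOne '' redMargin Λ) ≤ nrmOne μ :=
    fun μ hμ => Nat.sInf_le ⟨μ, hμ, rfl⟩
  have key : ∀ ν ∈ redMargin (Λ ∪ S),
      ν ∈ redMargin Λ ∨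
      ∃ μ ∈ S, ∃ m : Fin M, ν = μ + unitIdx M m ∧
        1 + sInf (nrmOne '' redMargin Λ) ≤ nrmOne ν := by
    rintro ν ⟨hpos, hout, hsub⟩
    refine or_iff_not_imp_left.2 fun hν => ?_
    obtain ⟨m, hm, hmΛ⟩ : ∃ m, 1 < ν m ∧ ν - unitIdx M m ∉ Λ := by
      by_contra! h
      exact hν ⟨hpos, fun h' => hout (Finset.mem_union_left S h'), h⟩
    have hmS := (Finset.mem_union.1 (hsub m hm)).resolve_left hmΛ
    have hnorm := nrmOne_add_unitIdx (one_le_sub_unitIdx hpos hm) m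
    have hmin := hle _ (hS hmS)
    rw [sub_unitIdx_add_unitIdx hm.le] at hnorm
    exact ⟨_, hmS, m, (sub_unitIdx_add_unitIdx hm.le).symm, by omega⟩
  refine ⟨?_, key⟩
  obtain ⟨ν, hν, hνeq⟩ := Nat.sInf_mem ((redMargin_nonempty hM (Λ ∪ S)).image nrmOne)
  rw [← hνeq]
  rcases key ν hν with h | ⟨_, _, _, _, h⟩
  · exact hle ν h
  · omega
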